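/- arXiv:2202.06003 — 2 statements merged into one kernel-verified Lean document; each statement's English description precedes it below -/
import Mathlib

section
/- Let γ ∈ (0,1) and c : S × S → ℝ. For every policy π and transition kernel U, the series defining the infinite-horizon discounted return J(π,U) converges absolutely; moreover, for every pair of policies π_pl, π_op and every α ∈ [0,1], J(π_pl, T^α[π_op]) = J(π_mix, T). -/
open Finset

/-- A policy: nonnegative and sums to one over actions at every state. -/
def IsPolicy {S A : Type*} [Fintype A] (π : S → A → ℝ) : Prop :=
  (∀ s a, 0 ≤ π s a) ∧ ∀ s, ∑ a, π s a = 1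

/-- A transition kernel: nonnegative and sums to one over next states. -/
def IsKernel {S A : Type*} [Fintype S] (U : S → A → S → ℝ) : Prop :=
  (∀ s a s', 0 ≤ U s a s') ∧ ∀ s a, ∑ s', U s a s' = 1

/-- An initial distribution over states. -/
def IsDist {S : Type*} [Fintype S] (P0 : S → ℝ) : Prop :=
  (∀ s, 0 ≤ P0 s) ∧ ∑ s, P0 s = 1

/-- The perturbed kernel `T^α[π_op]`. -/
def perturb {S A : Type*} [Fintype A] (T : S → A → S → ℝ) (πop : S → A → ℝ) (α : ℝ) :
    S → A → S → ℝ :=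
  fun s a s' => α * T s a s' + (1 - α) * ∑ b, πop s b * T s b s'

/-- The mixed policy `α·π_pl + (1−α)·π_op`. -/
def mix {S A : Type*} (πpl πop : S → A → ℝ) (α : ℝ) : S → A → ℝ :=
  fun s a => α * πpl s a + (1 - α) * πop s a

/-- The time-`t` state marginal of the Markov chain induced by policy `π` and kernel `U`
started at `P0`. -/
def marg {S A : Type*} [Fintype S] [Fintype A] (P0 : S → ℝ) (π : S → A → ℝ)
    (U : S → A → S → ℝ) : ℕ → S → ℝ
  | 0 => P0
  | t + 1 => fun s' => ∑ s, marg P0 π U t s * ∑ a, π s a * U s a s'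

/-- The infinite-horizon discounted return
`J(π,U) = ∑_t γ^t ∑_{s,s'} p_t(s) (∑_a π s a · U s a s') c(s,s')`. -/
noncomputable def discReturn {S A : Type*} [Fintype S] [Fintype A]
    (γ : ℝ) (c : S → S → ℝ) (P0 : S → ℝ) (π : S → A → ℝ) (U : S → A → S → ℝ) : ℝ :=
  ∑' t : ℕ, γ ^ t * ∑ s, ∑ s', marg P0 π U t s * (∑ a, π s a * U s a s') * c s s'

theorem stepProb_nonneg {S A : Type*} [Fintype S] [Fintype A] {π : S → A → ℝ}
    {U : S → A → S → ℝ} (hπ : IsPolicy π) (hU : IsKernel U) (s s' : S) :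
    0 ≤ ∑ a, π s a * U s a s' :=
  Finset.sum_nonneg fun a _ => mul_nonneg (hπ.1 s a) (hU.1 s a s')

theorem stepProb_sum {S A : Type*} [Fintype S] [Fintype A] {π : S → A → ℝ}
    {U : S → A → S → ℝ} (hπ : IsPolicy π) (hU : IsKernel U) (s : S) :
    ∑ s', ∑ a, π s a * U s a s' = 1 := by
  rw [Finset.sum_comm]
  simp_rw [← Finset.mul_sum, hU.2, mul_one]
  exact hπ.2 s

theorem marg_isDist {S A : Type*} [Fintype S] [Fintype A] {P0 : S → ℝ} {π : S → A → ℝ}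
    {U : S → A → S → ℝ} (hP0 : IsDist P0) (hπ : IsPolicy π) (hU : IsKernel U) (t : ℕ) :
    IsDist (marg P0 π U t) := by
  induction t with
  | zero => exact hP0
  | succ t ih =>
    refine ⟨fun s' => Finset.sum_nonneg fun s _ =>
      mul_nonneg (ih.1 s) (stepProb_nonneg hπ hU s s'), ?_⟩
    simp only [marg]
    rw [Finset.sum_comm]
    simp_rw [← Finset.mul_sum, stepProb_sum hπ hU, mul_one]
    exact ih.2

theorem dist_le_one {S : Type*} [Fintype S] {p : S → ℝ} (h : IsDist p) (s : S) : p s ≤ 1 := by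
  rw [← h.2]
  exact Finset.single_le_sum (fun i _ => h.1 i) (Finset.mem_univ s)

theorem stepProb_mix {S A : Type*} [Fintype A] (T : S → A → S → ℝ)
    {πpl : S → A → ℝ} (πop : S → A → ℝ) (h : IsPolicy πpl) (α : ℝ) (s s' : S) :
    ∑ a, πpl s a * perturb T πop α s a s' = ∑ a, mix πpl πop α s a * T s a s' := by
  simp only [perturb, mix, mul_add, add_mul, Finset.sum_add_distrib]
  rw [← Finset.sum_mul, h.2, one_mul, Finset.mul_sum]
  congr 1 <;> exact Finset.sum_congr rfl fun a _ => by ring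

theorem marg_mix {S A : Type*} [Fintype S] [Fintype A] (P0 : S → ℝ) (T : S → A → S → ℝ)
    {πpl : S → A → ℝ} (πop : S → A → ℝ) (h : IsPolicy πpl) (α : ℝ) (t : ℕ) :
    marg P0 πpl (perturb T πop α) t = marg P0 (mix πpl πop α) T t := by
  induction t with
  | zero => rfl
  | succ t ih => simp only [marg, ih, stepProb_mix T πop h]

/-- The series defining the discounted return converges absolutely, and the returns of the
player policy under the perturbed kernel and of the mixed policy under the original kernel
coincide. -/
theorem return_equivalence {S A : Type*} [Fintype S] [Fintype A] [Nonempty S] [Nonempty A]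
    (T : S → A → S → ℝ) (hT : IsKernel T)
    (P0 : S → ℝ) (hP0 : IsDist P0)
    (γ : ℝ) (hγ : γ ∈ Set.Ioo (0 : ℝ) 1) (c : S → S → ℝ) :
    (∀ (π : S → A → ℝ) (U : S → A → S → ℝ), IsPolicy π → IsKernel U →
        Summable (fun t : ℕ =>
          |γ ^ t * ∑ s, ∑ s', marg P0 π U t s * (∑ a, π s a * U s a s') * c s s'|)) ∧
      ∀ (πpl πop : S → A → ℝ), IsPolicy πpl → IsPolicy πop →
        ∀ α ∈ Set.Icc (0 : ℝ) 1,
          discReturn γ c P0 πpl (perturb T πop α) = discReturn γ c P0 (mix πpl πop α) T := by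
  constructor
  · intro π U hπ hU
    refine Summable.of_nonneg_of_le (fun _ => abs_nonneg _) (fun t => ?_)
      ((summable_geometric_of_lt_one hγ.1.le hγ.2).mul_right (∑ s, ∑ s', |c s s'|))
    rw [abs_mul, abs_of_nonneg (pow_nonneg hγ.1.le t)]
    refine mul_le_mul_of_nonneg_left ?_ (pow_nonneg hγ.1.le t)
    refine (Finset.abs_sum_le_sum_abs _ _).trans (Finset.sum_le_sum fun s _ => ?_)
    refine (Finset.abs_sum_le_sum_abs _ _).trans (Finset.sum_le_sum fun s' _ => ?_)
    have hm := marg_isDist hP0 hπ hU t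
    have hK : IsDist (fun s' => ∑ a, π s a * U s a s') :=
      ⟨stepProb_nonneg hπ hU s, stepProb_sum hπ hU s⟩
    have h1 := dist_le_one hK s'
    have h0 := hK.1 s'
    rw [abs_mul, abs_of_nonneg (mul_nonneg (hm.1 s) h0)]
    exact mul_le_of_le_one_left (abs_nonneg _) (mul_le_one₀ (dist_le_one hm s) h0 h1)
  · intro πpl πop hpl _ α _
    simp only [discReturn, marg_mix P0 T πop hpl, stepProb_mix T πop hpl]
end

section
/- Let γ ∈ (0,1), c : S × S → ℝ, and α ∈ [0,1]. For every player policy π_pl, the set of discounted returns attainable by kernels in the uncertainty set equals the set of discounted returns attainable by mixing with opponent policies: { J(π_pl, U) : U ∈ 𝒯^α } = { J(α·π_pl + (1−α)·π_op, T) : π_op a policy }, where α·π_pl + (1−α)·π_op denotes the mixed policy. -/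
open Finset

theorem step_eq {S A : Type*} [Fintype A] (T : S → A → S → ℝ) (α : ℝ)
    (πpl πop : S → A → ℝ) (hpl : IsPolicy πpl) (s s' : S) :
    ∑ a, πpl s a * perturb T πop α s a s' = ∑ a, mix πpl πop α s a * T s a s' := by
  have h1 : ∀ a, πpl s a * perturb T πop α s a s'
      = α * (πpl s a * T s a s') + πpl s a * ((1 - α) * ∑ b, πop s b * T s b s') := by
    intro a; unfold perturb; ring
  have h2 : ∀ a, mix πpl πop α s a * T s a s'
      = α * (πpl s a * T s a s') + (1 - α) * (πop s a * T s a s') := by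
    intro a; unfold mix; ring
  simp only [h1, h2, Finset.sum_add_distrib, ← Finset.mul_sum, ← Finset.sum_mul, hpl.2 s, one_mul]

theorem marg_eq {S A : Type*} [Fintype S] [Fintype A] (T : S → A → S → ℝ) (P0 : S → ℝ) (α : ℝ)
    (πpl πop : S → A → ℝ) (hpl : IsPolicy πpl) (t : ℕ) :
    marg P0 πpl (perturb T πop α) t = marg P0 (mix πpl πop α) T t := by
  induction t with
  | zero => rfl
  | succ t ih =>
    funext s'
    simp only [marg, ih, step_eq T α πpl πop hpl]

theorem discReturn_eq {S A : Type*} [Fintype S] [Fintype A] (T : S → A → S → ℝ) (P0 : S → ℝ)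
    (γ : ℝ) (c : S → S → ℝ) (α : ℝ) (πpl πop : S → A → ℝ) (hpl : IsPolicy πpl) :
    discReturn γ c P0 πpl (perturb T πop α) = discReturn γ c P0 (mix πpl πop α) T := by
  simp only [discReturn, marg_eq T P0 α πpl πop hpl, step_eq T α πpl πop hpl]

/-- The set of discounted returns attainable by kernels in the uncertainty set
`𝒯^α = { T^α[π_op] : π_op a policy }` equals the set of returns attainable by mixing the
player policy with opponent policies. -/
theorem attainable_returns_eq {S A : Type*} [Fintype S] [Fintype A] [Nonempty S] [Nonempty A]
    (T : S → A → S → ℝ) (hT : IsKernel T)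
    (P0 : S → ℝ) (hP0 : IsDist P0)
    (γ : ℝ) (hγ : γ ∈ Set.Ioo (0 : ℝ) 1) (c : S → S → ℝ)
    (α : ℝ) (hα : α ∈ Set.Icc (0 : ℝ) 1)
    (πpl : S → A → ℝ) (hpl : IsPolicy πpl) :
    {x : ℝ | ∃ U ∈ {V | ∃ πop : S → A → ℝ, IsPolicy πop ∧ V = perturb T πop α},
        x = discReturn γ c P0 πpl U}
      = {x : ℝ | ∃ πop : S → A → ℝ, IsPolicy πop ∧
          x = discReturn γ c P0 (mix πpl πop α) T} := by
  ext x
  constructor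
  · rintro ⟨U, ⟨πop, hop, rfl⟩, rfl⟩
    exact ⟨πop, hop, discReturn_eq T P0 γ c α πpl πop hpl⟩
  · rintro ⟨πop, hop, rfl⟩
    exact ⟨_, ⟨πop, hop, rfl⟩, (discReturn_eq T P0 γ c α πpl πop hpl).symm⟩
end
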